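/- Let d ≥ 1 and k ≥ 0 be integers and α ∈ [0,1] with k + α > 0. Then the Hausdorff, packing, lower box and upper box orders of the space 𝓕^{d,k,α} endowed with the C^0 sup-norm all coincide and equal d/(k + α): ord_H 𝓕^{d,k,α} = ord_P 𝓕^{d,k,α} = lower-ord_B 𝓕^{d,k,α} = upper-ord_B 𝓕^{d,k,α} = d/(k + α). -/

import Mathlib

open Filter MeasureTheory Metric Set
open scoped ENNReal Topology NNReal

noncomputable section

/-- A *scaling* is a family `(s α)_{α>0}` of positive non-decreasing functions on `(0,1)`
such that for all `α > β > 0` there is `λ₀ > 1` with, for every `λ ∈ (1, λ₀)`,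
`s α ε / s β (ε^λ) → 0` and `s α ε / (s β ε)^λ → 0` as `ε → 0⁺`. -/
def IsScaling (s : ℝ → ℝ → ℝ) : Prop :=
  (∀ α : ℝ, 0 < α → ∀ ε ∈ Set.Ioo (0:ℝ) 1, 0 < s α ε) ∧
  (∀ α : ℝ, 0 < α → MonotoneOn (s α) (Set.Ioo (0:ℝ) 1)) ∧
  (∀ α β : ℝ, 0 < β → β < α → ∃ l₀ > (1:ℝ), ∀ l ∈ Set.Ioo (1:ℝ) l₀,
    Tendsto (fun ε : ℝ => s α ε / s β (ε ^ l)) (𝓝[>] (0:ℝ)) (𝓝 0) ∧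
    Tendsto (fun ε : ℝ => s α ε / (s β ε) ^ l) (𝓝[>] (0:ℝ)) (𝓝 0))

/-- The covering number `N_ε(E)`: minimal cardinality of a finite cover of `E` by balls of
radius `ε` centered in `E` (`+∞` if there is no such finite cover). -/
def coveringNumber {X : Type*} [MetricSpace X] (E : Set X) (ε : ℝ) : ℝ≥0∞ :=
  ⨅ (t : Finset X) (_ : (↑t : Set X) ⊆ E ∧ E ⊆ ⋃ x ∈ t, ball x ε), (t.card : ℝ≥0∞)

/-- Lower box scale of a set. -/
def lowerBoxScale {X : Type*} [MetricSpace X] (s : ℝ → ℝ → ℝ) (E : Set X) : ℝ≥0∞ :=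
  ⨆ (α : ℝ) (_ : 0 < α ∧ Tendsto (fun ε : ℝ => coveringNumber E ε * ENNReal.ofReal (s α ε))
      (𝓝[>] (0:ℝ)) (𝓝 (⊤ : ℝ≥0∞))), ENNReal.ofReal α

/-- Upper box scale of a set. -/
def upperBoxScale {X : Type*} [MetricSpace X] (s : ℝ → ℝ → ℝ) (E : Set X) : ℝ≥0∞ :=
  ⨅ (α : ℝ) (_ : 0 < α ∧ Tendsto (fun ε : ℝ => coveringNumber E ε * ENNReal.ofReal (s α ε))
      (𝓝[>] (0:ℝ)) (𝓝 (0 : ℝ≥0∞))), ENNReal.ofReal α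

/-- `H_ε^φ(E)`: Hausdorff pre-measure at scale `ε`, via countable covers by balls of radii
at most `ε`. -/
def hausdorffPre {X : Type*} [MetricSpace X] (φ : ℝ → ℝ) (E : Set X) (ε : ℝ) : ℝ≥0∞ :=
  ⨅ (c : ℕ → X) (r : ℕ → ℝ) (t : Set ℕ)
    (_ : (∀ n ∈ t, r n ∈ Set.Ioc (0:ℝ) ε) ∧ E ⊆ ⋃ n ∈ t, ball (c n) (r n)),
    ∑' n : t, ENNReal.ofReal (φ (r n))

/-- `H^φ(E) = lim_{ε→0} H_ε^φ(E)`. -/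
def hausdorffMeasureOf {X : Type*} [MetricSpace X] (φ : ℝ → ℝ) (E : Set X) : ℝ≥0∞ :=
  ⨆ (ε : ℝ) (_ : 0 < ε), hausdorffPre φ E ε

/-- Hausdorff scale of a set. -/
def hausdorffScale {X : Type*} [MetricSpace X] (s : ℝ → ℝ → ℝ) (E : Set X) : ℝ≥0∞ :=
  ⨆ (α : ℝ) (_ : 0 < α ∧ hausdorffMeasureOf (s α) E = ⊤), ENNReal.ofReal α

/-- Packing scale of a set, via countable covers and upper box scales. -/
def packingScale {X : Type*} [MetricSpace X] (s : ℝ → ℝ → ℝ) (A : Set X) : ℝ≥0∞ :=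
  ⨅ (E : ℕ → Set X) (_ : (⋃ n, E n) = A), ⨆ n, upperBoxScale s (E n)

/-- Lower local scale of a measure at a point. -/
def lowerLocalScale {X : Type*} [MetricSpace X] [MeasurableSpace X]
    (s : ℝ → ℝ → ℝ) (μ : Measure X) (x : X) : ℝ≥0∞ :=
  ⨆ (α : ℝ) (_ : 0 < α ∧ Tendsto (fun ε : ℝ => μ (ball x ε) / ENNReal.ofReal (s α ε))
      (𝓝[>] (0:ℝ)) (𝓝 (0 : ℝ≥0∞))), ENNReal.ofReal α

/-- Upper local scale of a measure at a point. -/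
def upperLocalScale {X : Type*} [MetricSpace X] [MeasurableSpace X]
    (s : ℝ → ℝ → ℝ) (μ : Measure X) (x : X) : ℝ≥0∞ :=
  ⨅ (α : ℝ) (_ : 0 < α ∧ Tendsto (fun ε : ℝ => μ (ball x ε) / ENNReal.ofReal (s α ε))
      (𝓝[>] (0:ℝ)) (𝓝 (⊤ : ℝ≥0∞))), ENNReal.ofReal α

/-- Scale of a measure: infimum of the scale over Borel sets of positive measure. -/
def measureScale {X : Type*} [MetricSpace X] [MeasurableSpace X]
    (sc : Set X → ℝ≥0∞) (μ : Measure X) : ℝ≥0∞ :=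
  ⨅ (E : Set X) (_ : MeasurableSet E ∧ 0 < μ E), sc E

/-- `*`-scale of a measure: infimum of the scale over Borel sets of full measure. -/
def measureScaleStar {X : Type*} [MetricSpace X] [MeasurableSpace X]
    (sc : Set X → ℝ≥0∞) (μ : Measure X) : ℝ≥0∞ :=
  ⨅ (E : Set X) (_ : MeasurableSet E ∧ μ Eᶜ = 0), sc E

/-- Quantization number `Q_μ(ε)`. -/
def quantizationNumber {X : Type*} [MetricSpace X] [MeasurableSpace X]
    (μ : Measure X) (ε : ℝ) : ℝ≥0∞ :=
  ⨅ (t : Finset X) (_ : ∫⁻ x, (⨅ c ∈ t, edist x c) ∂μ ≤ ENNReal.ofReal ε), (t.card : ℝ≥0∞)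

/-- Lower quantization scale of a measure. -/
def lowerQuantScale {X : Type*} [MetricSpace X] [MeasurableSpace X]
    (s : ℝ → ℝ → ℝ) (μ : Measure X) : ℝ≥0∞ :=
  ⨆ (α : ℝ) (_ : 0 < α ∧ Tendsto (fun ε : ℝ => quantizationNumber μ ε * ENNReal.ofReal (s α ε))
      (𝓝[>] (0:ℝ)) (𝓝 (⊤ : ℝ≥0∞))), ENNReal.ofReal α

/-- Upper quantization scale of a measure. -/
def upperQuantScale {X : Type*} [MetricSpace X] [MeasurableSpace X]
    (s : ℝ → ℝ → ℝ) (μ : Measure X) : ℝ≥0∞ :=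
  ⨅ (α : ℝ) (_ : 0 < α ∧ Tendsto (fun ε : ℝ => quantizationNumber μ ε * ENNReal.ofReal (s α ε))
      (𝓝[>] (0:ℝ)) (𝓝 (0 : ℝ≥0∞))), ENNReal.ofReal α

/-- Packing number `Ñ_ε(E)`: maximal cardinality of an `ε`-separated subset of `E`. -/
def packingNumber {X : Type*} [MetricSpace X] (E : Set X) (ε : ℝ) : ℝ≥0∞ :=
  ⨆ (t : Finset X) (_ : (↑t : Set X) ⊆ E ∧ ∀ x ∈ t, ∀ y ∈ t, x ≠ y → ε ≤ dist x y),
    (t.card : ℝ≥0∞)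

/-- `P_ε^φ(E)`: supremum of `Σ φ(r_i)` over `ε`-packs of `E` (pairwise disjoint balls of `E`,
centered in `E`, with radii at most `ε`). -/
def packingPre {X : Type*} [MetricSpace X] (φ : ℝ → ℝ) (E : Set X) (ε : ℝ) : ℝ≥0∞ :=
  ⨆ (t : Finset (X × ℝ)) (_ : (∀ p ∈ t, p.1 ∈ E ∧ p.2 ∈ Set.Ioc (0:ℝ) ε) ∧
      (↑t : Set (X × ℝ)).Pairwise fun p q => Disjoint (ball p.1 p.2 ∩ E) (ball q.1 q.2 ∩ E)),
    ∑ p ∈ t, ENNReal.ofReal (φ p.2)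

/-- The packing pre-measure `P_0^φ(E) = lim_{ε→0} P_ε^φ(E)`. -/
def packingPre0 {X : Type*} [MetricSpace X] (φ : ℝ → ℝ) (E : Set X) : ℝ≥0∞ :=
  ⨅ (ε : ℝ) (_ : 0 < ε), packingPre φ E ε

/-- The packing `φ`-measure `P^φ(E)`. -/
def packingMeasureOf {X : Type*} [MetricSpace X] (φ : ℝ → ℝ) (E : Set X) : ℝ≥0∞ :=
  ⨅ (F : ℕ → Set X) (_ : (⋃ n, F n) = E), ∑' n, packingPre0 φ (F n)



/-- The unit cube `[0,1]^d`. -/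
abbrev Cube (d : ℕ) : Set (Fin d → ℝ) := Set.Icc 0 1

instance (d : ℕ) : CompactSpace (Cube d) := isCompact_iff_compactSpace.mp isCompact_Icc

/-- The functions `f : [0,1]^d → [-1,1]` of class `C^k` with `‖f‖_{C^k} ≤ 1` and,
when `α > 0`, with `D^k f` `α`-Hölder of constant `1`. -/
def FSet (d k : ℕ) (α : ℝ) : Set ((Fin d → ℝ) → ℝ) :=
  {f | ContDiffOn ℝ k f (Cube d) ∧
    (∀ x ∈ Cube d, f x ∈ Set.Icc (-1 : ℝ) 1) ∧
    (∀ j : ℕ, j ≤ k → ∀ x ∈ Cube d, ‖iteratedFDerivWithin ℝ j f (Cube d) x‖ ≤ 1) ∧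
    (0 < α → ∀ x ∈ Cube d, ∀ y ∈ Cube d,
      ‖iteratedFDerivWithin ℝ k f (Cube d) x - iteratedFDerivWithin ℝ k f (Cube d) y‖ ≤
        ‖x - y‖ ^ α)}

/-- The space `𝓕^{d,k,α}`, realized inside `C([0,1]^d, ℝ)` with the sup metric. -/
def FSpace (d k : ℕ) (α : ℝ) : Set C(Cube d, ℝ) :=
  {g | ∃ f ∈ FSet d k α, ∀ x : Cube d, g x = f x}

/-- The `ord` scaling `ε ↦ exp (-ε^{-α})`. -/
def ordFam : ℝ → ℝ → ℝ := fun α ε => Real.exp (-(ε ^ (-α)))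



theorem ordFam_pos (β ε : ℝ) : 0 < ordFam β ε := Real.exp_pos _

theorem ordFam_anti {β β' ε : ℝ} (h0 : 0 < ε) (h1 : ε ≤ 1) (h : β ≤ β') :
    ordFam β' ε ≤ ordFam β ε := by
  unfold ordFam
  apply Real.exp_le_exp.mpr
  have := Real.rpow_le_rpow_of_exponent_ge h0 h1 (neg_le_neg h)
  linarith

theorem hausdorffPre_le_tsum {X : Type*} [MetricSpace X] [Nonempty X] (φ : ℝ → ℝ) (E : Set X)
    (ε : ℝ) {ι : Type*} [Countable ι] (c : ι → X) (r : ι → ℝ) (hr : ∀ i, r i ∈ Set.Ioc (0:ℝ) ε)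
    (hE : E ⊆ ⋃ i, ball (c i) (r i)) :
    hausdorffPre φ E ε ≤ ∑' i, ENNReal.ofReal (φ (r i)) := by
  obtain ⟨e, he⟩ := exists_injective_nat ι
  unfold hausdorffPre
  refine (iInf_le_of_le (Function.extend e c (fun _ => Classical.arbitrary X))
    (iInf_le_of_le (Function.extend e r (fun _ => 0)) (iInf_le_of_le (Set.range e)
      (iInf_le_of_le ⟨?_, ?_⟩ ?_))))
  · rintro _ ⟨i, rfl⟩
    rw [he.extend_apply]; exact hr i
  · intro x hx
    obtain ⟨i, hi⟩ := mem_iUnion.mp (hE hx)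
    simp only [mem_iUnion]
    refine ⟨e i, ⟨i, rfl⟩, ?_⟩
    rw [he.extend_apply, he.extend_apply]; exact hi
  · rw [← (Equiv.ofInjective e he).tsum_eq]
    simp [he.extend_apply]

theorem hausdorffPre_le_cover {X : Type*} [MetricSpace X] [Nonempty X] (φ : ℝ → ℝ) (E : Set X)
    {ε r : ℝ} (hr : 0 < r) (hrε : r ≤ ε) (hφ : 0 < φ r) :
    hausdorffPre φ E ε ≤ coveringNumber E r * ENNReal.ofReal (φ r) := by
  have h0 : ENNReal.ofReal (φ r) ≠ 0 := by simpa using hφ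
  rw [← ENNReal.div_le_iff_le_mul (Or.inl h0) (Or.inl ENNReal.ofReal_ne_top)]
  unfold _root_.coveringNumber
  refine le_iInf₂ fun t ht => ENNReal.div_le_of_le_mul ?_
  refine (hausdorffPre_le_tsum φ E ε (fun i : t => (i : X)) (fun _ => r) (fun _ => ⟨hr, hrε⟩)
    ?_).trans ?_
  · intro x hx
    have := ht.2 hx
    simp only [mem_iUnion] at this ⊢
    obtain ⟨i, hi, hx⟩ := this
    exact ⟨⟨i, hi⟩, hx⟩
  · rw [tsum_fintype]; simp

theorem exists_cover_of_lt {X : Type*} [MetricSpace X] (E : Set X)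
    {r : ℝ} {s x : ℝ≥0∞} (hs : s ≠ 0) (hs' : s ≠ ⊤) (h : coveringNumber E r * s < x) :
    ∃ t : Finset X, E ⊆ (⋃ y ∈ t, ball y r) ∧ (t.card : ℝ≥0∞) * s < x := by
  rw [← ENNReal.lt_div_iff_mul_lt (Or.inl hs) (Or.inl hs')] at h
  unfold _root_.coveringNumber at h
  simp only [iInf_lt_iff] at h
  obtain ⟨t, ht, h⟩ := h
  exact ⟨t, ht.2, (ENNReal.lt_div_iff_mul_lt (Or.inl hs) (Or.inl hs')).mp h⟩

theorem hausdorffPre_zero_of_union {X : Type*} [MetricSpace X] [Nonempty X] (φ : ℝ → ℝ)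
    (hφ : ∀ ε, 0 < φ ε) (A : Set X) (E : ℕ → Set X) (hA : (⋃ n, E n) = A)
    (h : ∀ n, Tendsto (fun ε : ℝ => coveringNumber (E n) ε * ENNReal.ofReal (φ ε))
      (𝓝[>] (0:ℝ)) (𝓝 (0 : ℝ≥0∞))) (ε : ℝ) (hε : 0 < ε) : hausdorffPre φ A ε ≤ 1 := by
  obtain ⟨δ, hδ, hδs⟩ := ENNReal.exists_pos_sum_of_countable' (one_ne_zero (α := ℝ≥0∞)) ℕ
  have key : ∀ n, ∃ r : ℝ, r ∈ Set.Ioc 0 ε ∧ ∃ t : Finset X, E n ⊆ (⋃ y ∈ t, ball y r) ∧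
      (t.card : ℝ≥0∞) * ENNReal.ofReal (φ r) < δ n := by
    intro n
    have h1 := (h n).eventually (gt_mem_nhds (hδ n))
    have h2 : ∀ᶠ r in 𝓝[>] (0:ℝ), r ∈ Set.Ioc 0 ε := Ioc_mem_nhdsGT hε
    obtain ⟨r, hr1, hr2⟩ := (h1.and h2).exists
    exact ⟨r, hr2, exists_cover_of_lt _ (by simpa using hφ r) ENNReal.ofReal_ne_top hr1⟩
  choose r hr t ht hts using key
  refine (hausdorffPre_le_tsum φ A ε (ι := Σ n, t n) (fun i => (i.2 : X)) (fun i => r i.1)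
    (fun i => hr i.1) ?_).trans ?_
  · intro x hx
    rw [← hA] at hx
    obtain ⟨n, hn⟩ := mem_iUnion.mp hx
    have := ht n hn
    simp only [mem_iUnion] at this ⊢
    obtain ⟨i, hi, hx⟩ := this
    exact ⟨⟨n, ⟨i, hi⟩⟩, hx⟩
  · rw [ENNReal.tsum_sigma']
    refine le_trans (ENNReal.tsum_le_tsum fun n => ?_) hδs.le
    rw [tsum_fintype]
    simpa using (hts n).le

theorem orders_of_bounds {X : Type*} [MetricSpace X] [Nonempty X] (F : Set X) (D : ℝ)
    (hD : 0 < D)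
    (hU : ∀ β, D < β → Tendsto (fun ε : ℝ => coveringNumber F ε * ENNReal.ofReal (ordFam β ε))
      (𝓝[>] (0:ℝ)) (𝓝 (0 : ℝ≥0∞)))
    (hL : ∀ β, 0 < β → β < D → ∀ K : ℝ≥0∞, K ≠ ⊤ →
      ∃ ε > 0, K ≤ hausdorffPre (ordFam β) F ε) :
    hausdorffScale ordFam F = ENNReal.ofReal D ∧
    packingScale ordFam F = ENNReal.ofReal D ∧
    lowerBoxScale ordFam F = ENNReal.ofReal D ∧
    upperBoxScale ordFam F = ENNReal.ofReal D := by
  have hsm : ∀ b : ℝ, 0 < b → ∀ᶠ r in 𝓝[>] (0:ℝ), r ∈ Set.Ioc 0 b := fun b hb =>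
    Ioc_mem_nhdsGT hb
  -- approximations
  have up : ∀ x : ℝ≥0∞, (∀ β, D < β → x ≤ ENNReal.ofReal β) → x ≤ ENNReal.ofReal D := by
    intro x hx
    refine ge_of_tendsto (x := 𝓝[>] D) (f := fun β => ENNReal.ofReal β) ?_ ?_
    · exact (ENNReal.continuous_ofReal.tendsto D).mono_left nhdsWithin_le_nhds
    · filter_upwards [self_mem_nhdsWithin] with β hβ using hx β hβ
  have dn : ∀ x : ℝ≥0∞, (∀ β, 0 < β → β < D → ENNReal.ofReal β ≤ x) → ENNReal.ofReal D ≤ x := by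
    intro x hx
    refine le_of_tendsto (x := 𝓝[<] D) (f := fun β => ENNReal.ofReal β) ?_ ?_
    · exact (ENNReal.continuous_ofReal.tendsto D).mono_left nhdsWithin_le_nhds
    · filter_upwards [Ioo_mem_nhdsLT hD] with β hβ using hx β hβ.1 hβ.2
  have hL2 : ∀ β, 0 < β → β < D → Tendsto
      (fun ε : ℝ => coveringNumber F ε * ENNReal.ofReal (ordFam β ε)) (𝓝[>] (0:ℝ))
      (𝓝 (⊤ : ℝ≥0∞)) := by
    intro β h0 h1
    rw [ENNReal.tendsto_nhds_top_iff_nnreal]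
    intro K
    obtain ⟨ε, hε, hK⟩ := hL β h0 h1 (K + 1) (by finiteness)
    filter_upwards [hsm ε hε] with r hr
    refine lt_of_lt_of_le ?_ (hK.trans (hausdorffPre_le_cover _ F hr.1 hr.2 (ordFam_pos _ _)))
    exact ENNReal.lt_add_right (by finiteness) one_ne_zero
  have upU : upperBoxScale ordFam F ≤ ENNReal.ofReal D :=
    up _ fun β hβ => iInf₂_le_of_le β ⟨hD.trans hβ, hU β hβ⟩ le_rfl
  have hH : ∀ β, 0 < β → β < D → hausdorffMeasureOf (ordFam β) F = ⊤ := by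
    intro β h0 h1
    refine ENNReal.eq_top_of_forall_nnreal_le fun K => ?_
    obtain ⟨ε, hε, hK⟩ := hL β h0 h1 K (by finiteness)
    exact hK.trans (le_iSup₂_of_le ε hε le_rfl)
  -- packing-type lower bound
  have pk : ENNReal.ofReal D ≤ packingScale ordFam F := by
    unfold packingScale
    refine le_iInf₂ fun E hE => ?_
    by_contra! hlt
    obtain ⟨β, hβ, hβ0, hβD⟩ : ∃ β : ℝ, (⨆ n, upperBoxScale ordFam (E n)) < ENNReal.ofReal β ∧
        0 < β ∧ β < D := by
      obtain ⟨y, hy1, hy2⟩ := exists_between hlt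
      refine ⟨y.toReal, ?_, ?_, ?_⟩
      · rwa [ENNReal.ofReal_toReal hy2.ne_top]
      · exact ENNReal.toReal_pos (ne_bot_of_gt hy1) hy2.ne_top
      · exact (ENNReal.lt_ofReal_iff_toReal_lt hy2.ne_top).mp hy2
    have hz : ∀ n, Tendsto (fun ε : ℝ => coveringNumber (E n) ε * ENNReal.ofReal (ordFam β ε))
      (𝓝[>] (0:ℝ)) (𝓝 (0 : ℝ≥0∞)) := by
      intro n
      have h1 := (le_iSup (fun n => upperBoxScale ordFam (E n)) n).trans_lt hβ
      simp only [upperBoxScale, iInf_lt_iff] at h1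
      obtain ⟨a, ⟨ha0, ha⟩, hab⟩ := h1
      have hab' : a < β := (ENNReal.ofReal_lt_ofReal_iff hβ0).mp hab
      refine tendsto_of_tendsto_of_tendsto_of_le_of_le' tendsto_const_nhds ha
        (Eventually.of_forall fun _ => zero_le) ?_
      filter_upwards [hsm 1 one_pos] with r hr
      gcongr
      exact ordFam_anti hr.1 hr.2 hab'.le
    obtain ⟨ε, hε, hK⟩ := hL β hβ0 hβD 2 (by finiteness)
    have := hK.trans (hausdorffPre_zero_of_union _ (ordFam_pos β) F E hE hz ε hε)
    norm_num at this
  have pu : packingScale ordFam F ≤ upperBoxScale ordFam F :=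
    iInf₂_le_of_le (fun _ => F) (iUnion_const F) (iSup_le fun _ => le_rfl)
  refine ⟨le_antisymm ?_ ?_, le_antisymm (pu.trans upU) pk, le_antisymm ?_ ?_,
    le_antisymm upU (pk.trans pu)⟩
  · refine iSup₂_le fun β ⟨hβ0, hβ⟩ => ENNReal.ofReal_le_ofReal ?_
    by_contra! hlt
    have : hausdorffMeasureOf (ordFam β) F ≤ 0 := by
      refine iSup₂_le fun ε hε => ?_
      refine ge_of_tendsto (hU β hlt) ?_
      filter_upwards [hsm ε hε] with r hr
      exact hausdorffPre_le_cover _ F hr.1 hr.2 (ordFam_pos _ _)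
    rw [hβ] at this
    simp at this
  · exact dn _ fun β h0 h1 => le_iSup₂_of_le β ⟨h0, hH β h0 h1⟩ le_rfl
  · refine iSup₂_le fun β ⟨hβ0, hβ⟩ => ENNReal.ofReal_le_ofReal ?_
    by_contra! hlt
    have := tendsto_nhds_unique hβ (hU β hlt)
    simp at this
  · exact dn _ fun β h0 h1 => le_iSup₂_of_le β ⟨h0, hL2 β h0 h1⟩ le_rfl

theorem cube_uniqueDiffOn (d : ℕ) : UniqueDiffOn ℝ (Cube d) := by
  rw [show Cube d = Set.pi univ (fun _ => Set.Icc (0:ℝ) 1) by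
    rw [Set.pi_univ_Icc]; rfl]
  exact UniqueDiffOn.univ_pi fun _ => uniqueDiffOn_Icc zero_lt_one

theorem cmm_norm_le (d j : ℕ) (T : ContinuousMultilinearMap ℝ (fun _ : Fin j => Fin d → ℝ) ℝ)
    (η : ℝ) (hη : 0 ≤ η)
    (h : ∀ i : Fin j → Fin d, |T (fun l => Pi.single (i l) 1)| ≤ η) : ‖T‖ ≤ (d : ℝ) ^ j * η := by
  refine T.opNorm_le_bound (by positivity) fun v => ?_
  have hv : v = fun l => ∑ i, v l i • (Pi.single i (1:ℝ) : Fin d → ℝ) := by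
    funext l
    exact pi_eq_sum_univ' (v l)
  have : T v = ∑ i : Fin j → Fin d, (∏ l, v l (i l)) • T (fun l => Pi.single (i l) 1) := by
    conv_lhs => rw [hv]
    rw [T.map_sum]
    refine Finset.sum_congr rfl fun i _ => ?_
    rw [T.map_smul_univ]
  rw [this]
  refine (norm_sum_le _ _).trans ?_
  have : ∀ i ∈ (Finset.univ : Finset (Fin j → Fin d)),
      ‖(∏ l, v l (i l)) • T (fun l => Pi.single (i l) 1)‖ ≤ (∏ l, ‖v l‖) * η := by
    intro i _
    rw [norm_smul, norm_prod]
    gcongr with l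
    · exact norm_le_pi_norm (v l) (i l)
    · exact h i
  refine (Finset.sum_le_card_nsmul _ _ _ this).trans ?_
  simp
  apply le_of_eq; ring

theorem taylor_bound (d k : ℕ) (α δ : ℝ) (hδ : 0 < δ) (hα : 0 ≤ α) (hδ1 : δ ≤ 1)
    (h : (Fin d → ℝ) → ℝ) (hc : ContDiffOn ℝ k h (Cube d)) (p : Fin d → ℝ) (hp : p ∈ Cube d)
    (h1 : ∀ j ≤ k, ‖iteratedFDerivWithin ℝ j h (Cube d) p‖ ≤ δ ^ ((k:ℝ) + α))
    (h2 : ∀ x ∈ Cube d, ‖x - p‖ ≤ δ →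
      ‖iteratedFDerivWithin ℝ k h (Cube d) x - iteratedFDerivWithin ℝ k h (Cube d) p‖ ≤ 4 * δ ^ α)
    (m : ℕ) (hm : m ≤ k) : ∀ x ∈ Cube d, ‖x - p‖ ≤ δ →
      ‖iteratedFDerivWithin ℝ (k - m) h (Cube d) x‖ ≤ (m + 5) * δ ^ (m + α) := by
  induction m with
  | zero =>
    intro x hx hxp
    have e1 := h1 k le_rfl
    have e2 := h2 x hx hxp
    have e3 : δ ^ ((k:ℝ) + α) ≤ δ ^ α :=
      Real.rpow_le_rpow_of_exponent_ge hδ hδ1 (by have := Nat.cast_nonneg (α := ℝ) k; linarith)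
    have e4 := norm_le_norm_add_norm_sub (iteratedFDerivWithin ℝ k h (Cube d) p)
      (iteratedFDerivWithin ℝ k h (Cube d) x)
    rw [norm_sub_rev] at e4
    simp only [Nat.sub_zero, Nat.cast_zero, zero_add]
    linarith
  | succ m ih =>
    intro x hx hxp
    have ih := ih (by omega)
    set j := k - (m + 1) with hj
    have hjk : k - m = j + 1 := by omega
    rw [hjk] at ih
    have hU := cube_uniqueDiffOn d
    have hdiff : DifferentiableOn ℝ (iteratedFDerivWithin ℝ j h (Cube d)) (Cube d) :=
      hc.differentiableOn_iteratedFDerivWithin (by exact_mod_cast (by omega : j < k)) hU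
    have mv := Convex.norm_image_sub_le_of_norm_hasFDerivWithin_le (𝕜 := ℝ)
      (f := iteratedFDerivWithin ℝ j h (Cube d))
      (f' := fun y => fderivWithin ℝ (iteratedFDerivWithin ℝ j h (Cube d)) (Cube d) y)
      (s := Cube d ∩ closedBall p δ) (C := (m + 5) * δ ^ (m + α)) (x := p) (y := x)
      (fun y hy => ((hdiff y hy.1).hasFDerivWithinAt).mono inter_subset_left)
      (fun y hy => by
        rw [norm_fderivWithin_iteratedFDerivWithin]
        exact ih y hy.1 (by simpa [dist_eq_norm] using hy.2))
      ((convex_Icc _ _).inter (convex_closedBall _ _))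
      ⟨hp, by simp [hδ.le]⟩ ⟨hx, by simpa [dist_eq_norm] using hxp⟩
    have e1 := h1 j (by omega)
    have e3 : δ ^ ((k:ℝ) + α) ≤ δ ^ (((m + 1 : ℕ):ℝ) + α) :=
      Real.rpow_le_rpow_of_exponent_ge hδ hδ1 (by
        have : ((m + 1 : ℕ):ℝ) ≤ k := by exact_mod_cast hm
        linarith)
    have e4 := norm_le_norm_add_norm_sub (iteratedFDerivWithin ℝ j h (Cube d) p)
      (iteratedFDerivWithin ℝ j h (Cube d) x)
    rw [norm_sub_rev] at e4
    have e5 : ((m:ℝ) + 5) * δ ^ (m + α) * ‖x - p‖ ≤ (m + 5) * δ ^ (((m + 1 : ℕ):ℝ) + α) := by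
      rw [show (((m + 1 : ℕ):ℝ) + α) = (m + α) + 1 by push_cast; ring, Real.rpow_add_one hδ.ne',
        ← mul_assoc]
      gcongr
    push_cast at *
    linarith

theorem coveringNumber_le_card {X T : Type*} [MetricSpace X] [Fintype T] (E : Set X) (ε : ℝ)
    (Φ : X → T) (h : ∀ x ∈ E, ∀ y ∈ E, Φ x = Φ y → dist x y < ε) :
    coveringNumber E ε ≤ Fintype.card T := by
  classical
  have hex : ∀ c : Φ '' E, ∃ x ∈ E, Φ x = c := fun c => c.2
  choose s hs hs' using hex
  let t : Finset X := (Finset.univ : Finset (Φ '' E)).image s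
  unfold _root_.coveringNumber
  refine iInf₂_le_of_le t ⟨?_, ?_⟩ ?_
  · intro x hx
    simp only [t, Finset.coe_image, Set.mem_image] at hx
    obtain ⟨c, -, rfl⟩ := hx
    exact hs c
  · intro x hx
    simp only [mem_iUnion]
    refine ⟨s ⟨Φ x, x, hx, rfl⟩, by simp [t], ?_⟩
    rw [mem_ball]
    exact h _ hx _ (hs _) (hs' ⟨Φ x, x, hx, rfl⟩).symm
  · have : t.card ≤ Fintype.card T := by
      refine Finset.card_image_le.trans ?_
      rw [Finset.card_univ]
      exact Fintype.card_subtype_le _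
    exact_mod_cast this

theorem cover_bound (d k : ℕ) (hd : 1 ≤ d) (α : ℝ) (hα : α ∈ Set.Icc (0:ℝ) 1)
    (M Q : ℕ) (ε : ℝ) (hM : 1 ≤ M)
    (hQ : (d:ℝ) ^ k * (M:ℝ) ^ ((k:ℝ) + α) ≤ Q)
    (hε : ((k:ℝ) + 5) * ((M:ℝ)⁻¹) ^ ((k:ℝ) + α) < ε) :
    coveringNumber (FSpace d k α) ε ≤
      ((2 * Q + 1) ^ ((M + 1) ^ d * Fintype.card (Σ j : Fin (k + 1), (Fin j → Fin d))) : ℕ) := by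
  classical
  set J := Fintype.card (Σ j : Fin (k + 1), (Fin j → Fin d))
  have hMpos : (0:ℝ) < M := by exact_mod_cast hM
  have hQpos : (0:ℝ) < Q := lt_of_lt_of_le (by positivity) hQ
  let rep : C(Cube d, ℝ) → (Fin d → ℝ) → ℝ := fun g =>
    if hg : g ∈ FSpace d k α then hg.choose else 0
  have hrep : ∀ g ∈ FSpace d k α, rep g ∈ FSet d k α ∧ ∀ x : Cube d, g x = rep g x := by
    intro g hg
    simp only [rep, hg, dif_pos]
    exact hg.choose_spec
  let pt : (Fin d → Fin (M + 1)) → (Fin d → ℝ) := fun q i => (q i : ℕ) / (M:ℝ)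
  have hpt : ∀ q, pt q ∈ Cube d := by
    intro q
    refine ⟨fun i => by simp only [pt]; positivity, fun i => ?_⟩
    simp only [pt, Pi.one_apply]
    rw [div_le_one hMpos]
    exact_mod_cast (Nat.lt_succ_iff.mp (q i).2)
  let val : C(Cube d, ℝ) → (Fin d → Fin (M + 1)) → (Σ j : Fin (k + 1), (Fin j → Fin d)) → ℝ :=
    fun g q σ => iteratedFDerivWithin ℝ σ.1 (rep g) (Cube d) (pt q)
      (fun l => Pi.single (σ.2 l) 1)
  have hval : ∀ g ∈ FSpace d k α, ∀ q σ, |val g q σ| ≤ 1 := by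
    intro g hg q σ
    have h1 := (hrep g hg).1.2.2.1 σ.1 (Nat.lt_succ_iff.mp σ.1.2) (pt q) (hpt q)
    have h2 := (iteratedFDerivWithin ℝ σ.1 (rep g) (Cube d) (pt q)).le_opNorm
      (fun l => Pi.single (σ.2 l) 1)
    simp only [Pi.norm_single, norm_one, Finset.prod_const_one, mul_one] at h2
    exact h2.trans h1
  let Φ : C(Cube d, ℝ) → ((Fin d → Fin (M + 1)) × (Σ j : Fin (k + 1), (Fin j → Fin d))) →
      Fin (2 * Q + 1) := fun g x => Fin.ofNat (2 * Q + 1) ⌊(val g x.1 x.2 + 1) * Q⌋₊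
  have hΦ : ∀ g ∈ FSpace d k α, ∀ g' ∈ FSpace d k α, Φ g = Φ g' → ∀ q σ,
      |val g q σ - val g' q σ| ≤ 1 / Q := by
    have hlt : ∀ g ∈ FSpace d k α, ∀ q σ, ⌊(val g q σ + 1) * Q⌋₊ % (2 * Q + 1) =
        ⌊(val g q σ + 1) * Q⌋₊ := by
      intro g hg q σ
      apply Nat.mod_eq_of_lt
      rw [Nat.lt_succ_iff]
      apply Nat.floor_le_of_le
      push_cast
      have := (abs_le.mp (hval g hg q σ)).2
      gcongr
      linarith
    intro g hg g' hg' heq q σ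
    have h1 := congrArg Fin.val (congrFun heq (q, σ))
    simp only [Φ, Fin.val_ofNat] at h1
    rw [hlt g hg, hlt g' hg'] at h1
    have a0 : 0 ≤ (val g q σ + 1) * Q := by
      have := (abs_le.mp (hval g hg q σ)).1
      exact mul_nonneg (by linarith) hQpos.le
    have a0' : 0 ≤ (val g' q σ + 1) * Q := by
      have := (abs_le.mp (hval g' hg' q σ)).1
      exact mul_nonneg (by linarith) hQpos.le
    have a1 := Nat.floor_le a0
    have a2 := Nat.lt_floor_add_one ((val g q σ + 1) * Q)
    have b1 := Nat.floor_le a0'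
    have b2 := Nat.lt_floor_add_one ((val g' q σ + 1) * Q)
    rw [h1] at a1 a2
    rw [abs_le, neg_le, le_div_iff₀ hQpos, le_div_iff₀ hQpos]
    constructor <;> nlinarith
  have hcard : Fintype.card (((Fin d → Fin (M + 1)) ×
      (Σ j : Fin (k + 1), (Fin j → Fin d))) → Fin (2 * Q + 1)) =
      (2 * Q + 1) ^ ((M + 1) ^ d * J) := by
    rw [Fintype.card_fun, Fintype.card_prod, Fintype.card_fin, Fintype.card_fun, Fintype.card_fin,
      Fintype.card_fin]
  rw [← hcard]
  refine coveringNumber_le_card _ _ Φ fun g hg g' hg' heq => ?_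
  have hkey := hΦ g hg g' hg' heq
  obtain ⟨⟨fc, -, -, fh⟩, fe⟩ := hrep g hg
  obtain ⟨⟨fc', -, -, fh'⟩, fe'⟩ := hrep g' hg'
  have fb := (hrep g hg).1.2.2.1
  have fb' := (hrep g' hg').1.2.2.1
  have hU := cube_uniqueDiffOn d
  have hsub : ∀ j ≤ k, ∀ x ∈ Cube d, iteratedFDerivWithin ℝ j (rep g - rep g') (Cube d) x =
      iteratedFDerivWithin ℝ j (rep g) (Cube d) x - iteratedFDerivWithin ℝ j (rep g') (Cube d) x := by
    intro j hj x hx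
    have hj' : ((j:ℕ) : WithTop ℕ∞) ≤ ((k:ℕ) : WithTop ℕ∞) := by exact_mod_cast hj
    exact iteratedFDerivWithin_sub_apply ((fc.of_le hj') x hx) ((fc'.of_le hj') x hx) hU hx
  have hδ0 : 0 < ((M:ℝ)⁻¹) := by positivity
  have hδ1 : ((M:ℝ)⁻¹) ≤ 1 := inv_le_one_of_one_le₀ (by exact_mod_cast hM)
  have hdist : dist g g' ≤ ((k:ℝ) + 5) * ((M:ℝ)⁻¹) ^ ((k:ℝ) + α) := by
    rw [ContinuousMap.dist_le (by positivity)]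
    intro x
    let q : Fin d → Fin (M + 1) := fun i => Fin.ofNat (M + 1) ⌊(x : Fin d → ℝ) i * M⌋₊
    have hqv : ∀ i, ((q i : ℕ)) = ⌊(x : Fin d → ℝ) i * M⌋₊ := by
      intro i
      simp only [q, Fin.val_ofNat]
      apply Nat.mod_eq_of_lt
      rw [Nat.lt_succ_iff]
      apply Nat.floor_le_of_le
      have := x.2.2 i
      simp only [Pi.one_apply] at this
      nlinarith
    have hxq : ‖(x : Fin d → ℝ) - pt q‖ ≤ (M:ℝ)⁻¹ := by
      rw [pi_norm_le_iff_of_nonneg hδ0.le]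
      intro i
      have hxi := x.2.1 i
      simp only [Pi.zero_apply] at hxi
      have a1 := Nat.floor_le (mul_nonneg hxi hMpos.le)
      have a2 := Nat.lt_floor_add_one ((x : Fin d → ℝ) i * M)
      rw [Pi.sub_apply, Real.norm_eq_abs]
      simp only [pt, hqv]
      have e : (x : Fin d → ℝ) i - (⌊(x : Fin d → ℝ) i * M⌋₊ : ℝ) / M =
        ((x : Fin d → ℝ) i * M - ⌊(x : Fin d → ℝ) i * M⌋₊) * (M:ℝ)⁻¹ := by
          field_simp
      rw [e, abs_of_nonneg (mul_nonneg (by linarith) hδ0.le)]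
      exact mul_le_of_le_one_left hδ0.le (by linarith)
    have T := taylor_bound d k α ((M:ℝ)⁻¹) hδ0 hα.1 hδ1 (rep g - rep g') (fc.sub fc') (pt q) (hpt q)
      ?_ ?_ k le_rfl x x.2 hxq
    · rw [Nat.sub_self, norm_iteratedFDerivWithin_zero, Pi.sub_apply, ← fe x, ← fe' x] at T
      rwa [dist_eq_norm]
    · intro j hj
      refine (cmm_norm_le d j _ (1 / Q) (by positivity) fun i => ?_).trans ?_
      · rw [hsub j hj _ (hpt q)]
        exact hkey q ⟨⟨j, Nat.lt_succ_of_le hj⟩, i⟩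
      · rw [Real.inv_rpow hMpos.le, mul_one_div, div_le_iff₀ hQpos, inv_mul_eq_div,
          le_div_iff₀ (by positivity)]
        refine le_trans ?_ hQ
        gcongr
        exact_mod_cast hd
    · intro y hy hyp
      rw [hsub k le_rfl y hy, hsub k le_rfl _ (hpt q)]
      rcases hα.1.eq_or_lt with h0 | h0
      · rw [← h0, Real.rpow_zero]
        have c1 := fb k le_rfl y hy
        have c2 := fb' k le_rfl y hy
        have c3 := fb k le_rfl _ (hpt q)
        have c4 := fb' k le_rfl _ (hpt q)
        refine (norm_sub_le _ _).trans ?_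
        have := norm_sub_le (iteratedFDerivWithin ℝ k (rep g) (Cube d) y)
          (iteratedFDerivWithin ℝ k (rep g') (Cube d) y)
        have := norm_sub_le (iteratedFDerivWithin ℝ k (rep g) (Cube d) (pt q))
          (iteratedFDerivWithin ℝ k (rep g') (Cube d) (pt q))
        linarith
      · have c1 := fh h0 y hy (pt q) (hpt q)
        have c2 := fh' h0 y hy (pt q) (hpt q)
        have c3 : ‖y - pt q‖ ^ α ≤ ((M:ℝ)⁻¹) ^ α := Real.rpow_le_rpow (norm_nonneg _) hyp hα.1
        rw [sub_sub_sub_comm]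
        have c4 : 0 ≤ ((M:ℝ)⁻¹) ^ α := by positivity
        refine (norm_sub_le _ _).trans (by linarith)
  exact lt_of_le_of_lt hdist hε

theorem cover_exp_bound (d k : ℕ) (hd : 1 ≤ d) (α : ℝ) (hα : α ∈ Set.Icc (0:ℝ) 1)
    (hkα : 0 < (k : ℝ) + α) (b : ℝ) (hb : (d : ℝ) / ((k : ℝ) + α) < b) :
    ∃ C : ℝ, ∀ ε : ℝ, 0 < ε → ε ≤ 1 →
      coveringNumber (FSpace d k α) ε ≤ ENNReal.ofReal (Real.exp (C * ε ^ (-b))) := by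
  set γ : ℝ := (k : ℝ) + α with hγ
  set s : ℝ := b - d / γ with hs
  have hs0 : 0 < s := by linarith
  set J := Fintype.card (Σ j : Fin (k + 1), (Fin j → Fin d)) with hJ
  set B : ℝ := (k:ℝ) + 6 with hB
  have hBpos : 0 < B := by positivity
  set C1 : ℝ := 2 * (d:ℝ) ^ k * 2 ^ γ * B + 3 with hC1
  have hC1pos : 0 < C1 := by positivity
  refine ⟨3 ^ d * B ^ ((d:ℝ) / γ) * J * (C1 ^ s / s), fun ε hε hε1 => ?_⟩
  set u : ℝ := ε⁻¹ with hu
  have hu1 : 1 ≤ u := (one_le_inv₀ hε).mpr hε1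
  have hu0 : 0 < u := by positivity
  have hεb : ε ^ (-b) = u ^ b := by rw [hu, Real.inv_rpow hε.le, Real.rpow_neg hε.le]
  rw [hεb]
  set R : ℝ := (B * u) ^ (1 / γ) with hR
  have hBu : 1 ≤ B * u := by
    have : 1 ≤ B := by rw [hB]; have := Nat.cast_nonneg (α := ℝ) k; linarith
    nlinarith
  have hR1 : 1 ≤ R := Real.one_le_rpow hBu (by positivity)
  have hRγ : R ^ γ = B * u := by
    rw [hR, ← Real.rpow_mul (by positivity), one_div_mul_cancel hkα.ne', Real.rpow_one]
  set M : ℕ := ⌈R⌉₊ with hM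
  have hMR : R ≤ M := Nat.le_ceil R
  have hMlt : (M:ℝ) < R + 1 := Nat.ceil_lt_add_one (by linarith)
  have hM1 : 1 ≤ M := by exact_mod_cast (hR1.trans hMR)
  set Q : ℕ := ⌈(d:ℝ) ^ k * (M:ℝ) ^ γ⌉₊ with hQ
  have hQ1 : (d:ℝ) ^ k * (M:ℝ) ^ γ ≤ Q := Nat.le_ceil _
  have hQlt : (Q:ℝ) < (d:ℝ) ^ k * (M:ℝ) ^ γ + 1 := Nat.ceil_lt_add_one (by positivity)
  have hMγ : (M:ℝ) ^ γ ≤ 2 ^ γ * (B * u) := by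
    rw [← hRγ, ← Real.mul_rpow (by norm_num) (by linarith)]
    exact Real.rpow_le_rpow (by positivity) (by linarith) hkα.le
  have hMγ' : B * u ≤ (M:ℝ) ^ γ := by
    rw [← hRγ]
    exact Real.rpow_le_rpow (by linarith) hMR hkα.le
  have hsmall : ((k:ℝ) + 5) * ((M:ℝ)⁻¹) ^ γ < ε := by
    rw [Real.inv_rpow (by positivity), ← div_eq_mul_inv, div_lt_iff₀ (by linarith)]
    have : ε * (B * u) = B := by rw [hu]; field_simp
    have : B ≤ ε * (M:ℝ) ^ γ := by rw [← this]; gcongr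
    linarith
  refine (cover_bound d k hd α hα M Q ε hM1 hQ1 hsmall).trans ?_
  rw [← hJ, ← ENNReal.ofReal_natCast]
  apply ENNReal.ofReal_le_ofReal
  have hpos : (0:ℝ) < ((2 * Q + 1 : ℕ):ℝ) := by positivity
  rw [Nat.cast_pow, ← Real.rpow_natCast, Real.rpow_def_of_pos hpos]
  apply Real.exp_le_exp.mpr
  have l1 : ((2 * Q + 1 : ℕ):ℝ) ≤ C1 * u := by
    push_cast
    have : (d:ℝ) ^ k * (M:ℝ) ^ γ ≤ (d:ℝ) ^ k * (2 ^ γ * (B * u)) := by gcongr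
    rw [hC1]
    nlinarith
  have l2 : Real.log ((2 * Q + 1 : ℕ):ℝ) ≤ C1 ^ s / s * u ^ s := by
    refine (Real.log_le_log hpos l1).trans ((Real.log_le_rpow_div (by positivity) hs0).trans ?_)
    rw [Real.mul_rpow hC1pos.le hu0.le]
    apply le_of_eq; ring
  have l3 : (((M + 1) ^ d * J : ℕ):ℝ) ≤ 3 ^ d * B ^ ((d:ℝ) / γ) * J * u ^ ((d:ℝ) / γ) := by
    push_cast
    have : ((M:ℝ) + 1) ^ d ≤ (3 * R) ^ d := by gcongr; linarith
    have e : R ^ d = B ^ ((d:ℝ) / γ) * u ^ ((d:ℝ) / γ) := by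
      rw [← Real.mul_rpow hBpos.le hu0.le, hR, ← Real.rpow_natCast, ← Real.rpow_mul (by positivity)]
      congr 1; ring
    rw [mul_pow, e] at this
    calc ((M:ℝ) + 1) ^ d * J ≤ (3 ^ d * (B ^ ((d:ℝ) / γ) * u ^ ((d:ℝ) / γ))) * J := by gcongr
      _ = _ := by ring
  have l0 : 0 ≤ C1 ^ s / s * u ^ s := by positivity
  calc _ ≤ (C1 ^ s / s * u ^ s) * (3 ^ d * B ^ ((d:ℝ) / γ) * J * u ^ ((d:ℝ) / γ)) := by
        gcongr
    _ = 3 ^ d * B ^ ((d:ℝ) / γ) * J * (C1 ^ s / s) * (u ^ s * u ^ ((d:ℝ) / γ)) := by ring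
    _ = _ := by
      rw [← Real.rpow_add hu0, hs, sub_add_cancel]

theorem cover_tendsto (d k : ℕ) (hd : 1 ≤ d) (α : ℝ) (hα : α ∈ Set.Icc (0:ℝ) 1)
    (hkα : 0 < (k : ℝ) + α) (β : ℝ) (hβ : (d : ℝ) / ((k : ℝ) + α) < β) :
    Tendsto (fun ε : ℝ => coveringNumber (FSpace d k α) ε * ENNReal.ofReal (ordFam β ε))
      (𝓝[>] (0:ℝ)) (𝓝 (0 : ℝ≥0∞)) := by
  obtain ⟨b, hb1, hb2⟩ := exists_between hβ
  have hb0 : 0 < b := lt_of_le_of_lt (by positivity) hb1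
  obtain ⟨C, hC⟩ := cover_exp_bound d k hd α hα hkα b hb1
  have hlim : Tendsto (fun ε : ℝ => ENNReal.ofReal
      (Real.exp (ε ^ (-b) * (C - ε ^ (-(β - b)))))) (𝓝[>] (0:ℝ)) (𝓝 0) := by
    rw [← ENNReal.ofReal_zero]
    refine (ENNReal.continuous_ofReal.tendsto 0).comp (Real.tendsto_exp_atBot.comp ?_)
    have t1 : Tendsto (fun ε : ℝ => ε ^ (-b)) (𝓝[>] (0:ℝ)) atTop :=
      tendsto_rpow_neg_nhdsGT_zero (by linarith)
    have t2 : Tendsto (fun ε : ℝ => ε ^ (-(β - b))) (𝓝[>] (0:ℝ)) atTop :=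
      tendsto_rpow_neg_nhdsGT_zero (by linarith)
    exact t1.atTop_mul_atBot₀ (tendsto_atBot_add_const_left _ C (tendsto_neg_atTop_atBot.comp t2))
  refine tendsto_of_tendsto_of_tendsto_of_le_of_le' tendsto_const_nhds hlim
    (Eventually.of_forall fun _ => zero_le) ?_
  filter_upwards [Ioc_mem_nhdsGT (zero_lt_one (α := ℝ))] with ε hε
  refine (mul_le_mul_left (hC ε hε.1 hε.2) _).trans ?_
  rw [← ENNReal.ofReal_mul (Real.exp_pos _).le]
  apply ENNReal.ofReal_le_ofReal
  unfold ordFam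
  rw [← Real.exp_add]
  apply le_of_eq
  congr 1
  rw [mul_sub, ← Real.rpow_add hε.1]
  rw [show -b + -(β - b) = -β by ring]
  ring

theorem mass_dist {X Ω : Type*} [MetricSpace X] [MeasurableSpace Ω] (μ : Measure Ω)
    [IsProbabilityMeasure μ] (G : Ω → X) (F : Set X) (hG : ∀ ω, G ω ∈ F) (φ : ℝ → ℝ) (ε : ℝ)
    (K : ℝ≥0∞)
    (h : ∀ c r, 0 < r → r ≤ ε → K * μ (G ⁻¹' ball c r) ≤ ENNReal.ofReal (φ r)) :
    K ≤ hausdorffPre φ F ε := by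
  unfold hausdorffPre
  refine le_iInf fun c => le_iInf fun r => le_iInf fun t => le_iInf fun ht => ?_
  have hcov : (univ : Set Ω) ⊆ ⋃ n : t, G ⁻¹' ball (c n) (r n) := by
    intro ω _
    have := ht.2 (hG ω)
    simp only [mem_iUnion] at this ⊢
    obtain ⟨n, hn, h⟩ := this
    exact ⟨⟨n, hn⟩, h⟩
  calc K = K * μ univ := by simp
    _ ≤ K * ∑' n : t, μ (G ⁻¹' ball (c n) (r n)) := by
      gcongr
      exact (measure_mono hcov).trans (measure_iUnion_le _)
    _ = ∑' n : t, K * μ (G ⁻¹' ball (c n) (r n)) := ENNReal.tsum_mul_left.symm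
    _ ≤ _ := ENNReal.tsum_le_tsum fun n => h _ _ (ht.1 n n.2).1 (ht.1 n n.2).2

theorem norm_sum_le_of_unique {ι V : Type*} [NormedAddCommGroup V] (S : Finset ι) (F : ι → V)
    (B : ℝ) (hB : 0 ≤ B) (h1 : ∀ i ∈ S, ‖F i‖ ≤ B)
    (h2 : ∀ i ∈ S, ∀ j ∈ S, i ≠ j → F i = 0 ∨ F j = 0) : ‖∑ i ∈ S, F i‖ ≤ B := by
  by_cases h : ∃ i ∈ S, F i ≠ 0
  · obtain ⟨i, hi, hne⟩ := h
    rw [Finset.sum_eq_single_of_mem i hi (fun j hj hji => (h2 i hi j hj hji.symm).resolve_left hne)]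
    exact h1 i hi
  · push Not at h
    rw [Finset.sum_eq_zero h]
    simpa using hB

theorem bump_exists (d k : ℕ) : ∃ (φ : (Fin d → ℝ) → ℝ) (M : ℝ), 1 ≤ M ∧ ContDiff ℝ (⊤ : ℕ∞) φ ∧
    φ 0 = 1 ∧ (∀ x, |φ x| ≤ 1) ∧
    (∀ x, 1 / 2 ≤ ‖x‖ → ∀ j, iteratedFDeriv ℝ j φ x = 0) ∧
    (∀ j ≤ k + 1, ∀ x, ‖iteratedFDeriv ℝ j φ x‖ ≤ M) := by
  let f : ContDiffBump (0 : Fin d → ℝ) := ⟨1/8, 1/4, by norm_num, by norm_num⟩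
  have hc : ContDiff ℝ (⊤ : ℕ∞) f := f.contDiff
  have hb : ∀ j : ℕ, ∃ C, ∀ x, ‖iteratedFDeriv ℝ j f x‖ ≤ C := fun j =>
    (f.hasCompactSupport.iteratedFDeriv (𝕜 := ℝ) j).exists_bound_of_continuous
      (hc.continuous_iteratedFDeriv (by exact_mod_cast le_top))
  choose C hC using hb
  refine ⟨f, 1 + ∑ j ∈ Finset.range (k + 2), |C j|, ?_, hc, ?_, ?_, ?_, ?_⟩
  · have : 0 ≤ ∑ j ∈ Finset.range (k + 2), |C j| := Finset.sum_nonneg fun _ _ => abs_nonneg _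
    linarith
  · exact f.one_of_mem_closedBall (by simp [f])
  · intro x
    rw [abs_of_nonneg f.nonneg]
    exact f.le_one
  · intro x hx j
    have hx' : x ∉ tsupport f := by
      rw [f.tsupport_eq]
      simp only [mem_closedBall, dist_zero_right, not_le, f]
      linarith
    by_contra hne
    exact hx' (support_iteratedFDeriv_subset (𝕜 := ℝ) j hne)
  · intro j hj x
    have h1 : |C j| ≤ ∑ j ∈ Finset.range (k + 2), |C j| :=
      Finset.single_le_sum (f := fun j => |C j|) (fun _ _ => abs_nonneg _)
        (Finset.mem_range.mpr (by omega))
    have := hC j x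
    have := le_abs_self (C j)
    linarith

/-- One level of the random series. -/
def level (d : ℕ) (φ : (Fin d → ℝ) → ℝ) (S : Finset (Fin d → ℕ)) (R : ℕ) (w : (Fin d → ℕ) → ℝ)
    (x : Fin d → ℝ) : ℝ := ∑ i ∈ S, w i * φ ((R:ℝ) • x - fun l => (i l : ℝ))

theorem sep_int {d : ℕ} {i j : Fin d → ℕ} (hij : i ≠ j) (y : Fin d → ℝ) :
    1 / 2 ≤ ‖y - fun l => (i l : ℝ)‖ ∨ 1 / 2 ≤ ‖y - fun l => (j l : ℝ)‖ := by
  by_contra! h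
  obtain ⟨l, hl⟩ := Function.ne_iff.mp hij
  have h1 := (norm_le_pi_norm (y - fun l => (i l : ℝ)) l).trans_lt h.1
  have h2 := (norm_le_pi_norm (y - fun l => (j l : ℝ)) l).trans_lt h.2
  simp only [Pi.sub_apply, Real.norm_eq_abs, abs_lt] at h1 h2
  have h3 : ((i l : ℝ)) < j l + 1 := by linarith
  have h4 : ((j l : ℝ)) < i l + 1 := by linarith
  have h3' : i l < j l + 1 := by exact_mod_cast h3
  have h4' : j l < i l + 1 := by exact_mod_cast h4
  omega

theorem level_contDiff (d : ℕ) (φ : (Fin d → ℝ) → ℝ) (hφ : ContDiff ℝ (⊤ : ℕ∞) φ)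
    (S : Finset (Fin d → ℕ)) (R : ℕ) (w : (Fin d → ℕ) → ℝ) :
    ContDiff ℝ (⊤ : ℕ∞) (level d φ S R w) := by
  unfold level
  fun_prop

theorem level_bound (d : ℕ) (φ : (Fin d → ℝ) → ℝ) (hφ : ContDiff ℝ (⊤ : ℕ∞) φ)
    (hz : ∀ x, 1 / 2 ≤ ‖x‖ → ∀ j, iteratedFDeriv ℝ j φ x = 0)
    (S : Finset (Fin d → ℕ)) (R : ℕ) (w : (Fin d → ℕ) → ℝ) (hw : ∀ i, |w i| ≤ 1) (j : ℕ) (B : ℝ)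
    (hB : ∀ x, ‖iteratedFDeriv ℝ j φ x‖ ≤ B) (x : Fin d → ℝ) :
    ‖iteratedFDeriv ℝ j (level d φ S R w) x‖ ≤ (R:ℝ) ^ j * B := by
  have hB0 : 0 ≤ B := (norm_nonneg _).trans (hB 0)
  have hj : ((j : ℕ) : WithTop ℕ∞) ≤ ((⊤ : ℕ∞) : WithTop ℕ∞) := by exact_mod_cast le_top
  have hφj : ContDiff ℝ j φ := hφ.of_le hj
  have hterm : ∀ i, iteratedFDeriv ℝ j (fun x => w i * φ ((R:ℝ) • x - fun l => (i l : ℝ))) x =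
      w i • ((R:ℝ) ^ j • iteratedFDeriv ℝ j φ ((R:ℝ) • x - fun l => (i l : ℝ))) := by
    intro i
    have e1 := iteratedFDeriv_const_smul_apply' (𝕜 := ℝ) (a := w i) (i := j) (x := x)
      (f := fun x => φ ((R:ℝ) • x - fun l => (i l : ℝ)))
      (ContDiff.contDiffAt (by fun_prop))
    simp only [smul_eq_mul] at e1
    rw [e1]
    have e2 := iteratedFDeriv_comp_const_smul (𝕜 := ℝ) (i := j) (R:ℝ)
      (f := fun y => φ (y - fun l => (i l : ℝ))) (by fun_prop)
    rw [e2]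
    beta_reduce
    rw [iteratedFDeriv_comp_sub]
  unfold level
  rw [iteratedFDeriv_sum (fun i _ => by fun_prop), Finset.sum_apply]
  simp only [hterm]
  refine norm_sum_le_of_unique _ _ _ (by positivity) ?_ ?_
  · intro i _
    rw [norm_smul, norm_smul, Real.norm_eq_abs, norm_pow, RCLike.norm_natCast]
    calc _ ≤ 1 * ((R:ℝ) ^ j * B) := by
          gcongr
          · exact hw i
          · exact hB _
      _ = _ := one_mul _
  · intro i _ i' _ hne
    rcases sep_int hne ((R:ℝ) • x) with h | h
    · left; rw [hz _ h]; simp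
    · right; rw [hz _ h]; simp

theorem level_center (d : ℕ) (φ : (Fin d → ℝ) → ℝ) (h0 : φ 0 = 1)
    (hz : ∀ x, 1 / 2 ≤ ‖x‖ → ∀ j, iteratedFDeriv ℝ j φ x = 0)
    (S : Finset (Fin d → ℕ)) (R : ℕ) (hR : 0 < R) (w : (Fin d → ℕ) → ℝ) (i : Fin d → ℕ)
    (hi : i ∈ S) : level d φ S R w (fun l => (i l : ℝ) / R) = w i := by
  have hR' : (R:ℝ) ≠ 0 := by positivity
  have e : ((R:ℝ) • fun l => (i l : ℝ) / R) = fun l => (i l : ℝ) := by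
    funext l
    simp only [Pi.smul_apply, smul_eq_mul]
    field_simp
  unfold level
  rw [Finset.sum_eq_single_of_mem i hi]
  · rw [e, sub_self, h0, mul_one]
  · intro j _ hj
    rw [e]
    have h1 : 1 / 2 ≤ ‖(fun l => (i l : ℝ)) - fun l => (j l : ℝ)‖ := by
      rcases sep_int hj.symm (fun l => (i l : ℝ)) with h | h
      · rw [sub_self, norm_zero] at h; norm_num at h
      · exact h
    have := congrArg norm (hz _ h1 0)
    rw [norm_iteratedFDeriv_zero, norm_zero, norm_eq_zero] at this
    rw [this, mul_zero]

theorem hasSum_fifth (b : ℝ) : HasSum (fun n : ℕ => b * (1 / 5 : ℝ) ^ (n + 1)) (b / 4) := by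
  have h := (hasSum_geometric_of_lt_one (r := (1 / 5 : ℝ)) (by norm_num) (by norm_num)).mul_left
    (b * (1 / 5))
  have e1 : (fun n : ℕ => b * (1 / 5 : ℝ) ^ (n + 1)) = fun n => b * (1 / 5) * (1 / 5) ^ n := by
    funext n; rw [pow_succ]; ring
  have e2 : b / 4 = b * (1 / 5) * (1 - 1 / 5)⁻¹ := by norm_num; ring
  rw [e1, e2]
  exact h

theorem series_mem_FSet (d k : ℕ) (α : ℝ) (hα : α ∈ Set.Icc (0:ℝ) 1) (a R : ℕ → ℝ) (M : ℝ)
    (hM : 0 ≤ M) (ha : ∀ n, 0 ≤ a n) (hR : ∀ n, 1 ≤ R n)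
    (g : ℕ → (Fin d → ℝ) → ℝ) (hg : ∀ n, ContDiff ℝ (⊤ : ℕ∞) (g n))
    (hb : ∀ n, ∀ j ≤ k + 1, ∀ x, ‖iteratedFDeriv ℝ j (g n) x‖ ≤ R n ^ j * M)
    (hs : ∀ n, a n * M * R n ^ ((k:ℝ) + α) ≤ (1 / 5) ^ (n + 1)) :
    ContDiff ℝ k (fun x => ∑' n, a n * g n x) ∧ (fun x => ∑' n, a n * g n x) ∈ FSet d k α := by
  have htop : ∀ j : ℕ, ((j : ℕ) : WithTop ℕ∞) ≤ ((⊤ : ℕ∞) : WithTop ℕ∞) := fun j => by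
    exact_mod_cast le_top
  have hf : ∀ n, ContDiff ℝ (⊤ : ℕ∞) (fun x => a n * g n x) := fun n =>
    contDiff_const.mul (hg n)
  have hder : ∀ n j x, iteratedFDeriv ℝ j (fun x => a n * g n x) x =
      a n • iteratedFDeriv ℝ j (g n) x := fun n j x =>
    iteratedFDeriv_const_smul_apply' (𝕜 := ℝ) (a := a n) (i := j) (x := x) (f := g n)
      ((hg n).of_le (htop j)).contDiffAt
  have hRpow : ∀ n, R n ^ k * R n ^ α = R n ^ ((k:ℝ) + α) := fun n => by
    rw [Real.rpow_add (by linarith [hR n]), Real.rpow_natCast]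
  have hbnd : ∀ (j n : ℕ) (x : Fin d → ℝ), j ≤ k →
      ‖iteratedFDeriv ℝ j (fun x => a n * g n x) x‖ ≤ 1 * (1 / 5 : ℝ) ^ (n + 1) := by
    intro j n x hj
    rw [hder, norm_smul, Real.norm_eq_abs, abs_of_nonneg (ha n), one_mul]
    refine le_trans ?_ (hs n)
    rw [mul_assoc]
    refine mul_le_mul_of_nonneg_left ((hb n j (by omega) x).trans ?_) (ha n)
    rw [mul_comm M]
    refine mul_le_mul_of_nonneg_right ?_ hM
    rw [← Real.rpow_natCast]
    refine Real.rpow_le_rpow_of_exponent_le (hR n) ?_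
    have : (j:ℝ) ≤ k := by exact_mod_cast hj
    linarith [hα.1]
  have hbnd' : ∀ (j n : ℕ) (x : Fin d → ℝ), (j : ℕ∞) ≤ (k : ℕ∞) →
      ‖iteratedFDeriv ℝ j (fun x => a n * g n x) x‖ ≤ 1 * (1 / 5 : ℝ) ^ (n + 1) :=
    fun j n x hj => hbnd j n x (by exact_mod_cast hj)
  have hfk : ∀ n, ContDiff ℝ ((k : ℕ∞) : WithTop ℕ∞) (fun x => a n * g n x) := fun n =>
    (hf n).of_le (htop k)
  have hsum := hasSum_fifth 1
  have hC : ContDiff ℝ k (fun x => ∑' n, a n * g n x) :=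
    contDiff_tsum (N := (k : ℕ∞)) hfk (fun _ _ => hsum.summable) hbnd'
  have hD : ∀ j ≤ k, ∀ x, iteratedFDeriv ℝ j (fun x => ∑' n, a n * g n x) x =
      ∑' n, iteratedFDeriv ℝ j (fun x => a n * g n x) x := fun j hj x =>
    iteratedFDeriv_tsum_apply (N := (k : ℕ∞)) hfk (fun _ _ => hsum.summable) hbnd'
      (by exact_mod_cast hj) x
  have hU := cube_uniqueDiffOn d
  have hW : ∀ j ≤ k, ∀ x ∈ Cube d,
      iteratedFDerivWithin ℝ j (fun x => ∑' n, a n * g n x) (Cube d) x =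
      ∑' n, iteratedFDeriv ℝ j (fun x => a n * g n x) x := by
    intro j hj x hx
    rw [iteratedFDerivWithin_eq_iteratedFDeriv hU _ hx, hD j hj x]
    exact (hC.of_le (by exact_mod_cast hj)).contDiffAt
  have hN : ∀ j ≤ k, ∀ x ∈ Cube d,
      ‖iteratedFDerivWithin ℝ j (fun x => ∑' n, a n * g n x) (Cube d) x‖ ≤ 1 := by
    intro j hj x hx
    rw [hW j hj x hx]
    refine (tsum_of_norm_bounded hsum fun n => hbnd j n x hj).trans (by norm_num)
  refine ⟨hC, hC.contDiffOn, ?_, hN, ?_⟩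
  · intro x hx
    have := hN 0 (Nat.zero_le _) x hx
    rw [norm_iteratedFDerivWithin_zero, Real.norm_eq_abs] at this
    exact abs_le.mp this
  · intro hα0 x hx y hy
    rw [hW k le_rfl x hx, hW k le_rfl y hy,
      ← Summable.tsum_sub (Summable.of_norm_bounded hsum.summable fun n => hbnd k n x le_rfl)
        (Summable.of_norm_bounded hsum.summable fun n => hbnd k n y le_rfl)]
    set t := ‖x - y‖ with ht
    have ht0 : 0 ≤ t := norm_nonneg _
    refine (tsum_of_norm_bounded (hasSum_fifth (2 * t ^ α)) fun n => ?_).trans ?_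
    · rw [hder, hder, ← smul_sub, norm_smul, Real.norm_eq_abs, abs_of_nonneg (ha n)]
      have hR0 : 0 < R n := by linarith [hR n]
      have key : ‖iteratedFDeriv ℝ k (g n) x - iteratedFDeriv ℝ k (g n) y‖ ≤
          2 * (R n ^ k * M) * (R n * t) ^ α := by
        rcases le_total (R n * t) 1 with h | h
        · have mv := Convex.norm_image_sub_le_of_norm_fderiv_le (𝕜 := ℝ)
            (f := iteratedFDeriv ℝ k (g n)) (s := univ) (C := R n ^ (k + 1) * M) (x := y) (y := x)
            (fun z _ => ((hg n).differentiable_iteratedFDeriv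
              (by exact_mod_cast ENat.natCast_lt_top k)) z)
            (fun z _ => by rw [norm_fderiv_iteratedFDeriv]; exact hb n (k + 1) le_rfl z)
            convex_univ (mem_univ _) (mem_univ _)
          have h1 : R n * t ≤ (R n * t) ^ α := by
            rcases ht0.eq_or_lt with h0 | h0
            · rw [← h0]; simp [Real.zero_rpow hα0.ne']
            · exact Real.self_le_rpow_of_le_one (by positivity) h hα.2
          have h2 : 0 ≤ (R n * t) ^ α := by positivity
          calc _ ≤ R n ^ (k + 1) * M * t := mv
            _ = (R n ^ k * M) * (R n * t) := by ring
            _ ≤ (R n ^ k * M) * (R n * t) ^ α := by gcongr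
            _ ≤ _ := by
              have : 0 ≤ (R n ^ k * M) * (R n * t) ^ α := by positivity
              linarith
        · have h1 : 1 ≤ (R n * t) ^ α := Real.one_le_rpow h hα.1
          have b1 := hb n k (by omega) x
          have b2 := hb n k (by omega) y
          have b3 : 0 ≤ R n ^ k * M := by positivity
          refine (norm_sub_le _ _).trans ?_
          nlinarith
      calc a n * _ ≤ a n * (2 * (R n ^ k * M) * (R n * t) ^ α) :=
            mul_le_mul_of_nonneg_left key (ha n)
        _ = 2 * t ^ α * (a n * M * (R n ^ k * R n ^ α)) := by
            rw [Real.mul_rpow hR0.le ht0]; ring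
        _ ≤ 2 * t ^ α * (1 / 5) ^ (n + 1) := by
            rw [hRpow]
            exact mul_le_mul_of_nonneg_left (hs n) (by positivity)
    · have : 0 ≤ t ^ α := by positivity
      linarith

theorem series_sep (a u : ℕ → ℝ) (m : ℕ)
    (hd : ∀ l, a (l + m) ≤ a m * (1 / 5) ^ l) (hu : Summable u)
    (h0 : ∀ l < m, u l = 0) (h1 : |u m| = a m) (h2 : ∀ l, |u l| ≤ 2 * a l) :
    a m / 2 ≤ |∑' l, u l| := by
  rw [← hu.sum_add_tsum_nat_add (m + 1), Finset.sum_range_succ,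
    Finset.sum_eq_zero (fun l hl => h0 l (Finset.mem_range.mp hl)), zero_add]
  have ht : ‖∑' i, u (i + (m + 1))‖ ≤ (2 * a m) / 4 := by
    refine tsum_of_norm_bounded (hasSum_fifth (2 * a m)) fun i => ?_
    rw [Real.norm_eq_abs]
    refine (h2 _).trans ?_
    have := hd (i + 1)
    rw [show i + 1 + m = i + (m + 1) by ring] at this
    linarith
  rw [Real.norm_eq_abs] at ht
  have := abs_sub_abs_le_abs_add (u m) (∑' i, u (i + (m + 1)))
  linarith

theorem asymp (K K0 ρ : ℝ) (d : ℕ) (hK : 0 < K) (hρ0 : 0 < ρ) (hρ : ρ < d) :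
    ∃ R0 : ℝ, ∀ R : ℝ, R0 ≤ R → 0 < R →
      K * Real.exp (-(Real.log 2 * R ^ d)) ≤ Real.exp (-(K0 * R ^ ρ)) := by
  have t1 : Tendsto (fun R : ℝ => R ^ ρ) atTop atTop := tendsto_rpow_atTop hρ0
  have t2 : Tendsto (fun R : ℝ => R ^ ((d:ℝ) - ρ)) atTop atTop := tendsto_rpow_atTop (by linarith)
  have t3 : Tendsto (fun R : ℝ => Real.log 2 * R ^ ((d:ℝ) - ρ) - K0) atTop atTop :=
    tendsto_atTop_add_const_right _ _ (t2.const_mul_atTop (Real.log_pos (by norm_num)))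
  have t4 := t1.atTop_mul_atTop₀ t3
  obtain ⟨R0, hR0⟩ := eventually_atTop.mp (t4.eventually_ge_atTop (Real.log K))
  refine ⟨R0, fun R hR hpos => ?_⟩
  have h := hR0 R hR
  rw [mul_sub, mul_left_comm, ← Real.rpow_add hpos, add_sub_cancel, Real.rpow_natCast] at h
  rw [← Real.exp_log hK, ← Real.exp_add]
  apply Real.exp_le_exp.mpr
  linarith

/-- The fair coin on `Bool`. -/
def coin : Measure Bool := (2⁻¹ : ℝ≥0∞) • Measure.count

instance : IsProbabilityMeasure coin := by
  constructor
  simp [coin, Measure.count_apply_finite]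
  exact ENNReal.inv_mul_cancel (by norm_num) (by norm_num)

theorem coin_singleton (b : Bool) : coin {b} = 2⁻¹ := by
  simp [coin]

theorem lower_bound (d k : ℕ) (α : ℝ) (hα : α ∈ Set.Icc (0:ℝ) 1)
    (hkα : 0 < (k : ℝ) + α) (β : ℝ) (hβ0 : 0 < β) (hβ : β < (d : ℝ) / ((k : ℝ) + α))
    (K : ℝ≥0∞) (hK : K ≠ ⊤) :
    ∃ ε > 0, K ≤ hausdorffPre (ordFam β) (FSpace d k α) ε := by
  obtain ⟨φ, M, hM1, hφ, hφ0, hφ1, hz, hφM⟩ := bump_exists d k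
  have hMpos : 0 < M := by linarith
  obtain ⟨γ', hγ1, hγ2⟩ : ∃ γ' : ℝ, (k:ℝ) + α < γ' ∧ γ' < d / β := by
    apply exists_between
    rw [lt_div_iff₀ hβ0]
    rw [lt_div_iff₀ hkα] at hβ
    linarith
  have hγ0 : 0 < γ' := by linarith
  have hρ : γ' * β < d := by rwa [lt_div_iff₀ hβ0] at hγ2
  obtain ⟨A, hA2, hA5⟩ : ∃ A : ℕ, 2 ≤ A ∧ (5:ℝ) ≤ (A:ℝ) ^ (γ' - (k + α)) := by
    have t : Tendsto (fun A : ℕ => (A:ℝ) ^ (γ' - (k + α))) atTop atTop :=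
      (tendsto_rpow_atTop (by linarith)).comp tendsto_natCast_atTop_atTop
    exact ((eventually_ge_atTop 2).and (t.eventually_ge_atTop 5)).exists
  have hA1 : (1:ℝ) ≤ A := by exact_mod_cast (by omega : 1 ≤ A)
  have hApos : (0:ℝ) < A := by linarith
  set θ : ℝ := (A:ℝ) ^ (-γ') with hθ
  have hθ0 : 0 < θ := by positivity
  have hθη : θ * (A:ℝ) ^ ((k:ℝ) + α) ≤ 1 / 5 := by
    rw [hθ, ← Real.rpow_add hApos, show -γ' + ((k:ℝ) + α) = -(γ' - (k + α)) by ring,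
      Real.rpow_neg hApos.le, one_div]
    exact inv_anti₀ (by norm_num) hA5
  have hθ5 : θ ≤ 1 / 5 := by
    have : 1 ≤ (A:ℝ) ^ ((k:ℝ) + α) := Real.one_le_rpow hA1 hkα.le
    nlinarith
  set R : ℕ → ℕ := fun n => A ^ (n + 1) with hRdef
  have hRpos : ∀ n, 0 < R n := fun n => by simp only [hRdef]; positivity
  set a : ℕ → ℝ := fun n => M⁻¹ * θ ^ (n + 1) with hadef
  have ha0 : ∀ n, 0 < a n := fun n => by simp only [hadef]; positivity
  have haM : ∀ n, a n * M * (R n : ℝ) ^ ((k:ℝ) + α) ≤ (1 / 5) ^ (n + 1) := by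
    intro n
    have e1 : (R n : ℝ) ^ ((k:ℝ) + α) = ((A:ℝ) ^ ((k:ℝ) + α)) ^ (n + 1) := by
      simp only [hRdef]
      push_cast
      rw [← Real.rpow_natCast, ← Real.rpow_mul hApos.le, mul_comm, Real.rpow_mul hApos.le,
        Real.rpow_natCast]
    have e2 : a n * M = θ ^ (n + 1) := by
      simp only [hadef]; field_simp
    rw [e1, e2, ← mul_pow]
    gcongr
  have had : ∀ m l, a (l + m) ≤ a m * (1 / 5) ^ l := by
    intro m l
    have : a (l + m) = a m * θ ^ l := by simp only [hadef]; ring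
    rw [this]
    have := (ha0 m).le
    gcongr
  have hanti : ∀ m n, m ≤ n → a n ≤ a m := by
    intro m n hmn
    obtain ⟨l, rfl⟩ := Nat.exists_eq_add_of_le' hmn
    refine (had m l).trans (mul_le_of_le_one_right (ha0 m).le ?_)
    exact pow_le_one₀ (by norm_num) (by norm_num)
  set S : ℕ → Finset (Fin d → ℕ) := fun n => Fintype.piFinset (fun _ => Finset.range (R n))
    with hS
  have hScard : ∀ n, (S n).card = R n ^ d := by
    intro n; simp [hS]
  let w : (ℕ × (Fin d → ℕ) → Bool) → ℕ → (Fin d → ℕ) → ℝ := fun ω n i => if ω (n, i) then 1 else 0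
  have hw : ∀ ω n i, |w ω n i| ≤ 1 := by
    intro ω n i
    simp only [w]
    split_ifs <;> simp
  let g : (ℕ × (Fin d → ℕ) → Bool) → ℕ → (Fin d → ℝ) → ℝ :=
    fun ω n => level d φ (S n) (R n) (w ω n)
  have hg1 : ∀ ω n x, |g ω n x| ≤ 1 := by
    intro ω n x
    have := level_bound d φ hφ hz (S n) (R n) (w ω n) (hw ω n) 0 1
      (fun x => by rw [norm_iteratedFDeriv_zero]; exact hφ1 x) x
    rw [norm_iteratedFDeriv_zero, pow_zero, one_mul] at this
    exact this
  have hser : ∀ ω, ContDiff ℝ k (fun x => ∑' n, a n * g ω n x) ∧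
      (fun x => ∑' n, a n * g ω n x) ∈ FSet d k α := fun ω =>
    series_mem_FSet d k α hα a (fun n => R n) M hMpos.le (fun n => (ha0 n).le)
      (fun n => by exact_mod_cast hRpos n) (g ω) (fun n => level_contDiff d φ hφ _ _ _)
      (fun n j hj x => level_bound d φ hφ hz (S n) (R n) (w ω n) (hw ω n) j M (hφM j hj) x) haM
  let G : (ℕ × (Fin d → ℕ) → Bool) → C(Cube d, ℝ) := fun ω =>
    ⟨fun x => ∑' n, a n * g ω n x, (hser ω).1.continuous.comp continuous_subtype_val⟩
  have hGF : ∀ ω, G ω ∈ FSpace d k α := fun ω => ⟨_, (hser ω).2, fun x => rfl⟩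
  have hasum : Summable a := by
    refine Summable.of_nonneg_of_le (fun n => (ha0 n).le) (fun n => had 0 n) ?_
    exact (summable_geometric_of_lt_one (by norm_num) (by norm_num)).mul_left _
  have hsummable : ∀ ω x, Summable (fun n => a n * g ω n x) := by
    intro ω x
    refine Summable.of_norm_bounded hasum fun n => ?_
    rw [norm_mul, Real.norm_eq_abs, Real.norm_eq_abs, abs_of_pos (ha0 n)]
    exact mul_le_of_le_one_right (ha0 n).le (hg1 ω n x)
  have hsep : ∀ n ω ω', dist (G ω) (G ω') < a n / 2 → ∀ i ∈ S n, ω (n, i) = ω' (n, i) := by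
    classical
    intro n ω ω' hdist
    by_contra! hne
    have hex : ∃ m, ∃ i ∈ S m, ω (m, i) ≠ ω' (m, i) := ⟨n, hne⟩
    obtain ⟨i, hi, hne'⟩ := Nat.find_spec hex
    have hmn : Nat.find hex ≤ n := Nat.find_min' hex hne
    have hmin : ∀ l < Nat.find hex, ∀ i ∈ S l, ω (l, i) = ω' (l, i) := by
      intro l hl
      have := Nat.find_min hex hl
      push Not at this
      exact this
    set m := Nat.find hex
    have hRm : (0:ℝ) < R m := by exact_mod_cast hRpos m
    have hx : (fun l => (i l : ℝ) / R m) ∈ Cube d := by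
      refine ⟨fun l => by simp only [Pi.zero_apply]; positivity, fun l => ?_⟩
      simp only [Pi.one_apply]
      rw [div_le_one hRm]
      have := Finset.mem_range.mp (Fintype.mem_piFinset.mp hi l)
      exact_mod_cast this.le
    have hD := series_sep a (fun l => a l * g ω l (fun l => (i l : ℝ) / R m) -
        a l * g ω' l (fun l => (i l : ℝ) / R m)) m (had m) ((hsummable ω _).sub (hsummable ω' _))
      ?_ ?_ ?_
    · rw [(hsummable ω _).tsum_sub (hsummable ω' _)] at hD
      have h3 := ContinuousMap.dist_apply_le_dist (f := G ω) (g := G ω') ⟨_, hx⟩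
      rw [Real.dist_eq] at h3
      have h4 := hanti m n hmn
      have h5 := (hD.trans h3).trans_lt hdist
      linarith
    · intro l hl
      have : g ω l = g ω' l := by
        funext x
        simp only [g, level]
        refine Finset.sum_congr rfl fun i hi => ?_
        simp only [w, hmin l hl i hi]
      simp only [this, sub_self]
    · simp only [g]
      rw [level_center d φ hφ0 hz (S m) (R m) (hRpos m) _ i hi,
        level_center d φ hφ0 hz (S m) (R m) (hRpos m) _ i hi, ← mul_sub, abs_mul,
        abs_of_pos (ha0 m)]
      have : |w ω m i - w ω' m i| = 1 := by
        simp only [w]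
        cases h1 : ω (m, i) <;> cases h2 : ω' (m, i) <;> simp_all
      rw [this, mul_one]
    · intro l
      rw [← mul_sub, abs_mul, abs_of_pos (ha0 l), mul_comm]
      refine mul_le_mul_of_nonneg_right ?_ (ha0 l).le
      refine (abs_sub _ _).trans ?_
      linarith [hg1 ω l (fun l => (i l : ℝ) / R m), hg1 ω' l (fun l => (i l : ℝ) / R m)]
  -- measure of balls
  set μ : Measure (ℕ × (Fin d → ℕ) → Bool) := Measure.infinitePi (fun _ => coin) with hμ
  have hball : ∀ n c r, r ≤ a n / 4 → μ (G ⁻¹' ball c r) ≤ (2⁻¹ : ℝ≥0∞) ^ (R n ^ d) := by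
    intro n c r hr
    rcases (G ⁻¹' ball c r).eq_empty_or_nonempty with he | ⟨ω₀, hω₀⟩
    · rw [he]; simp
    · have hsub : G ⁻¹' ball c r ⊆
          Set.pi (((S n).map ⟨fun i => (n, i), fun i j h => (Prod.mk.inj h).2⟩ :
            Finset (ℕ × (Fin d → ℕ))) : Set (ℕ × (Fin d → ℕ))) (fun p => {ω₀ p}) := by
        intro ω hω p hp
        simp only [Finset.coe_map, Function.Embedding.coeFn_mk, Set.mem_image,
          Finset.mem_coe] at hp
        obtain ⟨i, hi, rfl⟩ := hp
        refine hsep n ω ω₀ ?_ i hi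
        have h1 : dist (G ω) c < r := hω
        have h2 : dist (G ω₀) c < r := hω₀
        have := dist_triangle_right (G ω) (G ω₀) c
        linarith
      refine (measure_mono hsub).trans ?_
      rw [hμ, Measure.infinitePi_pi _ (fun _ _ => measurableSet_singleton _)]
      simp [coin_singleton, hScard]
  -- asymptotics
  set c0 : ℝ := M⁻¹ * θ / 4 with hc0
  have hc0pos : 0 < c0 := by positivity
  obtain ⟨R0, hR0⟩ := asymp (K.toReal + 1) ((c0 * 1) ^ (-β)) (γ' * β) d
    (by positivity) (by positivity) hρ
  obtain ⟨n0, hn0⟩ : ∃ n0 : ℕ, R0 ≤ n0 := exists_nat_ge R0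
  refine ⟨c0 * θ ^ (n0 + 1), by positivity, mass_dist μ G _ hGF _ _ _ fun c r hr0 hr => ?_⟩
  have hθ1 : θ < 1 := by linarith
  have hx1 : r / c0 ≤ θ ^ (n0 + 1) := by rw [div_le_iff₀ hc0pos]; linarith
  obtain ⟨n, hn1, hn2⟩ := exists_nat_pow_near_of_lt_one (x := r / c0) (y := θ) (by positivity)
    (hx1.trans (pow_le_one₀ hθ0.le hθ1.le)) hθ0 hθ1
  have hnn0 : n0 < n := by
    have := hn1.trans_le hx1
    rw [pow_lt_pow_iff_right_of_lt_one₀ hθ0 hθ1] at this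
    omega
  have hra : r ≤ a n / 4 := by
    rw [div_le_iff₀ hc0pos] at hn2
    refine hn2.trans (le_of_eq ?_)
    simp only [hadef, hc0]; ring
  have hRn : R0 ≤ (R n : ℝ) := by
    refine hn0.trans ?_
    have : n0 ≤ R n := by
      have := (Nat.lt_pow_self (n := n + 1) (show 1 < A by omega)).le
      simp only [hRdef]
      omega
    exact_mod_cast this
  have hmain := hR0 (R n) hRn (by exact_mod_cast hRpos n)
  have hrβ : r ^ (-β) ≤ (c0 * 1) ^ (-β) * (R n : ℝ) ^ (γ' * β) := by
    rw [mul_one]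
    have h1 : c0 * θ ^ (n + 1) ≤ r := by
      rw [lt_div_iff₀ hc0pos] at hn1; linarith
    refine (Real.rpow_le_rpow_of_nonpos (by positivity) h1 (by linarith)).trans (le_of_eq ?_)
    rw [Real.mul_rpow hc0pos.le (by positivity)]
    congr 1
    simp only [hRdef, hθ]
    push_cast
    rw [← Real.rpow_natCast, ← Real.rpow_natCast, ← Real.rpow_mul hApos.le,
      ← Real.rpow_mul hApos.le, ← Real.rpow_mul hApos.le]
    congr 1; ring
  refine (mul_le_mul_right (hball n c r hra) K).trans ?_
  have e1 : (2⁻¹ : ℝ≥0∞) ^ (R n ^ d) =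
      ENNReal.ofReal (Real.exp (-(Real.log 2 * (R n : ℝ) ^ d))) := by
    rw [show -(Real.log 2 * (R n : ℝ) ^ d) = ((R n ^ d : ℕ) : ℝ) * (- Real.log 2) by
      push_cast; ring, Real.exp_nat_mul, Real.exp_neg, Real.exp_log (by norm_num),
      ENNReal.ofReal_pow (by norm_num), ENNReal.ofReal_inv_of_pos (by norm_num)]
    norm_num
  rw [e1]
  calc K * ENNReal.ofReal (Real.exp (-(Real.log 2 * (R n : ℝ) ^ d)))
      ≤ ENNReal.ofReal (K.toReal + 1) *
        ENNReal.ofReal (Real.exp (-(Real.log 2 * (R n : ℝ) ^ d))) := by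
        gcongr
        exact ENNReal.le_ofReal_iff_toReal_le hK (by positivity) |>.mpr (by linarith)
    _ = ENNReal.ofReal ((K.toReal + 1) * Real.exp (-(Real.log 2 * (R n : ℝ) ^ d))) :=
        (ENNReal.ofReal_mul (by positivity)).symm
    _ ≤ _ := by
        apply ENNReal.ofReal_le_ofReal
        refine hmain.trans ?_
        unfold ordFam
        exact Real.exp_le_exp.mpr (by linarith)

/-- The Hausdorff, packing, lower box and upper box orders of `𝓕^{d,k,α}` all coincide
and are equal to `d/(k+α)`. -/
theorem orders_FSpace_eq (d k : ℕ) (hd : 1 ≤ d) (α : ℝ)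
    (hα : α ∈ Set.Icc (0:ℝ) 1) (hkα : 0 < (k : ℝ) + α) :
    hausdorffScale ordFam (FSpace d k α) = ENNReal.ofReal ((d : ℝ) / ((k : ℝ) + α)) ∧
    packingScale ordFam (FSpace d k α) = ENNReal.ofReal ((d : ℝ) / ((k : ℝ) + α)) ∧
    lowerBoxScale ordFam (FSpace d k α) = ENNReal.ofReal ((d : ℝ) / ((k : ℝ) + α)) ∧
    upperBoxScale ordFam (FSpace d k α) = ENNReal.ofReal ((d : ℝ) / ((k : ℝ) + α)) := by
  have hd' : (0:ℝ) < d := by exact_mod_cast hd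
  exact orders_of_bounds (FSpace d k α) _ (div_pos hd' hkα)
    (fun β hβ => cover_tendsto d k hd α hα hkα β hβ)
    (fun β h0 h1 K hK => lower_bound d k α hα hkα β h0 h1 K hK)

end
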